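/- Let G₁, …, Gₙ be groups and let G be a subgroup of G₁ × ⋯ × Gₙ such that each projection πᵢ : G → Gᵢ is surjective. Then G is a normal subgroup of G₁ × ⋯ × Gₙ if and only if G contains the commutator subgroup of G₁ × ⋯ × Gₙ. -/

import Mathlib

open scoped commutatorElement

/-- The commutator of an element supported at one coordinate with `y` depends on `y` only through
that coordinate. -/
theorem commutatorElement_mulSingle_eq {ι : Type*} [DecidableEq ι] {G : ι → Type*}
    [∀ i, Group (G i)] {i : ι} (a : G i) {y z : ∀ j, G j} (h : y i = z i) :
    ⁅Pi.mulSingle i a, y⁆ = ⁅Pi.mulSingle i a, z⁆ := by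
  funext j
  rcases eq_or_ne j i with rfl | hj
  · simp [commutatorElement_def, h]
  · simp [commutatorElement_def, hj]

/-- A normal subgroup of a finite product that surjects onto every factor contains the
commutator subgroup of the product. -/
theorem Subgroup.commutator_le_of_normal_of_surjective_eval {ι : Type*} [Finite ι]
    {G : ι → Type*} [∀ i, Group (G i)] (H : Subgroup (∀ i, G i)) [H.Normal]
    (hsurj : ∀ i, Function.Surjective fun g : H => (g : ∀ j, G j) i) :
    _root_.commutator (∀ i, G i) ≤ H := by
  classical
  have key : ∀ x, x ∈ (Subgroup.center ((∀ i, G i) ⧸ H)).comap (QuotientGroup.mk' H) := by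
    intro x
    refine Subgroup.pi_mem_of_mulSingle_mem x fun i => ?_
    rw [Subgroup.mem_comap, Subgroup.mem_center_iff]
    intro q
    obtain ⟨y, rfl⟩ := QuotientGroup.mk'_surjective H q
    obtain ⟨h, hh⟩ := hsurj i (y i)
    refine (commutatorElement_eq_one_iff_mul_comm.mp ?_).symm
    rw [← map_commutatorElement, commutatorElement_mulSingle_eq (x i) hh.symm,
      map_commutatorElement, commutatorElement_eq_one_iff_mul_comm,
      show QuotientGroup.mk' H h = 1 from (QuotientGroup.eq_one_iff _).mpr h.2]
    simp
  rw [_root_.commutator_def, Subgroup.commutator_le]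
  intro x _ y _
  rw [← QuotientGroup.eq_one_iff, ← QuotientGroup.mk'_apply, map_commutatorElement,
    commutatorElement_eq_one_iff_mul_comm]
  exact (Subgroup.mem_center_iff.mp (key x) _).symm


/-- Let `G₁, …, Gₙ` be groups and `G ≤ G₁ × ⋯ × Gₙ` a subgroup such that
each coordinate projection `πᵢ : G → Gᵢ` is surjective.  Then `G` is a normal subgroup of
`G₁ × ⋯ × Gₙ` if and only if `G` contains the commutator subgroup of `G₁ × ⋯ × Gₙ`. -/
theorem stmt5 {n : ℕ} (G : Fin n → Type*) [∀ i, Group (G i)]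
    (H : Subgroup (∀ i, G i))
    (hsurj : ∀ i, Function.Surjective fun g : H => (g : ∀ j, G j) i) :
    H.Normal ↔ commutator (∀ i, G i) ≤ H :=
  ⟨fun _ => H.commutator_le_of_normal_of_surjective_eval hsurj, Subgroup.Normal.of_commutator_le _⟩
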